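/- Uniform support bound for the semi-discrete Lagrangian scheme. Let V be a probability vector field satisfying (H1) with constant C > 0, let T > 0 and μ₀ ∈ 𝒫_c(ℝ^d) with supp(μ₀) ⊂ B(0,R). Then for every N ∈ ℕ the semi-discrete Lagrangian scheme satisfies supp(μ̄^N_t) ⊂ B(0, e^{CT}(R+1)) for all t ∈ [0,T]. -/

import Mathlib

open MeasureTheory Set Filter Topology Metric
open scoped ENNReal NNReal Classical

noncomputable section

abbrev Euc (d : ℕ) : Type := EuclideanSpace ℝ (Fin d)

/-- The (topological) support of a measure. -/
def msupp {X : Type*} [TopologicalSpace X] [MeasurableSpace X] (μ : Measure X) : Set X :=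
  {x | ∀ U : Set X, IsOpen U → x ∈ U → 0 < μ U}

/-- Compactly supported Borel probability measures (membership in `𝒫_c`). -/
def Pc {X : Type*} [TopologicalSpace X] [MeasurableSpace X] (μ : Measure X) : Prop :=
  IsProbabilityMeasure μ ∧ ∃ K : Set X, IsCompact K ∧ μ Kᶜ = 0

/-- A probability vector field: `π₁ ♯ V[μ] = μ`. -/
def IsPVF {d : ℕ} (V : Measure (Euc d) → Measure (Euc d × Euc d)) : Prop :=
  ∀ μ : Measure (Euc d), IsProbabilityMeasure μ →
    IsProbabilityMeasure (V μ) ∧ (V μ).map Prod.fst = μ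

/-- Solution of the measure differential equation `μ̇_t = V[μ_t]` on `[0,T]`. -/
def IsMDESol {d : ℕ} (T : ℝ) (V : Measure (Euc d) → Measure (Euc d × Euc d))
    (μ : ℝ → Measure (Euc d)) : Prop :=
  ∀ f : Euc d → ℝ, ContDiff ℝ (⊤ : ℕ∞) f → HasCompactSupport f →
    IntegrableOn (fun t => ∫ p : Euc d × Euc d, fderiv ℝ f p.1 p.2 ∂(V (μ t))) (Icc 0 T) ∧
    ∀ t ∈ Icc (0 : ℝ) T,
      (∫ x, f x ∂(μ t)) - (∫ x, f x ∂(μ 0)) =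
        ∫ s in Icc (0 : ℝ) t, (∫ p : Euc d × Euc d, fderiv ℝ f p.1 p.2 ∂(V (μ s)))

/-- 1-Wasserstein distance via the Kantorovich–Rubinstein duality. -/
def W1 {X : Type*} [MeasurableSpace X] [PseudoMetricSpace X] (μ ν : Measure X) : ℝ :=
  ⨆ f : {f : X → ℝ // LipschitzWith 1 f}, ((∫ x, f.1 x ∂μ) - ∫ x, f.1 x ∂ν)

/-- Disintegration `ν_x[·]` of a measure on a product space w.r.t. the first projection. -/
def disint {d : ℕ} (m : Measure (Euc d × Euc d)) : Euc d → Measure (Euc d) :=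
  if h : IsFiniteMeasure m then
    haveI := h
    fun x => m.condKernel x
  else fun _ => 0

/-- Barycenter of the disintegration: `x ↦ ∫ v dν_x(v)`. -/
def bary {d : ℕ} (m : Measure (Euc d × Euc d)) (x : Euc d) : Euc d :=
  ∫ v, v ∂(disint m x)


section Hypotheses

/-- Condition (H1) with a given constant `C`. -/
def H1cond {d : ℕ} (C : ℝ) (V : Measure (Euc d) → Measure (Euc d × Euc d)) : Prop :=
  ∀ μ : Measure (Euc d), Pc μ →
    ∀ p ∈ msupp (V μ), ‖p.2‖ ≤ C * (1 + ⨆ x : msupp μ, ‖(x : Euc d)‖)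

/-- Hypothesis (H1): sublinearity of the PVF. -/
def H1 {d : ℕ} (V : Measure (Euc d) → Measure (Euc d × Euc d)) : Prop :=
  ∃ C > 0, H1cond C V

/-- Hypothesis (H2): continuity of the PVF `V : 𝒫_c(ℝ^d) → 𝒫_c(Tℝ^d)` w.r.t. Wasserstein. -/
def H2 {d : ℕ} (V : Measure (Euc d) → Measure (Euc d × Euc d)) : Prop :=
  (∀ μ, Pc μ → Pc (V μ)) ∧
  ∀ μ, Pc μ → ∀ ε > 0, ∃ δ > 0, ∀ ν, Pc ν → W1 μ ν < δ → W1 (V μ) (V ν) < ε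

/-- Transference plans between two measures. -/
def Couplings {X Y : Type*} [MeasurableSpace X] [MeasurableSpace Y]
    (μ : Measure X) (ν : Measure Y) : Set (Measure (X × Y)) :=
  {π | π.map Prod.fst = μ ∧ π.map Prod.snd = ν}

/-- 1-Wasserstein distance as infimum over transference plans. -/
def Wplan {X : Type*} [MeasurableSpace X] [PseudoMetricSpace X] (μ ν : Measure X) : ℝ :=
  sInf ((fun π : Measure (X × X) => ∫ p, dist p.1 p.2 ∂π) '' Couplings μ ν)

/-- Optimal transference plans. -/
def OptCouplings {X : Type*} [MeasurableSpace X] [PseudoMetricSpace X] (μ ν : Measure X) :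
    Set (Measure (X × X)) :=
  {π | π ∈ Couplings μ ν ∧ (∫ p, dist p.1 p.2 ∂π) = Wplan μ ν}

/-- The quantity `𝒲(V₁,V₂)`: minimal fiber displacement over plans whose base marginal is
an optimal plan between the two base measures. -/
def Wfib {d : ℕ} (V₁ V₂ : Measure (Euc d × Euc d)) : ℝ :=
  sInf ((fun P : Measure ((Euc d × Euc d) × (Euc d × Euc d)) => ∫ q, ‖q.1.2 - q.2.2‖ ∂P) ''
    {P | P ∈ Couplings V₁ V₂ ∧
      P.map (fun q => (q.1.1, q.2.1)) ∈ OptCouplings (V₁.map Prod.fst) (V₂.map Prod.fst)})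

/-- Hypothesis (H3): local Lipschitz continuity of the PVF in the `μ` variable. -/
def H3 {d : ℕ} (V : Measure (Euc d) → Measure (Euc d × Euc d)) : Prop :=
  ∀ R > 0, ∃ L > 0, ∀ μ ν : Measure (Euc d), Pc μ → Pc ν →
    msupp μ ⊆ ball (0 : Euc d) R → msupp ν ⊆ ball (0 : Euc d) R →
    Wfib (V μ) (V ν) ≤ L * W1 μ ν

end Hypotheses

section Schemes

/-- The semi-discrete (in time) Lagrangian scheme at grid times `t_k = k T/N`. -/
def lagrStep {d : ℕ} (T : ℝ) (N : ℕ) (V : Measure (Euc d) → Measure (Euc d × Euc d))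
    (μ₀ : Measure (Euc d)) : ℕ → Measure (Euc d)
  | 0 => μ₀
  | k + 1 => (V (lagrStep T N V μ₀ k)).map fun p => p.1 + (T / N) • p.2

/-- Time interpolation of the semi-discrete Lagrangian scheme. -/
def lagrT {d : ℕ} (T : ℝ) (N : ℕ) (V : Measure (Euc d) → Measure (Euc d × Euc d))
    (μ₀ : Measure (Euc d)) (t : ℝ) : Measure (Euc d) :=
  if t ≤ 0 then μ₀
  else
    (V (lagrStep T N V μ₀ (⌈t / (T / N)⌉.toNat - 1))).map fun p =>
      p.1 + (t - (↑(⌈t / (T / N)⌉.toNat - 1) : ℝ) * (T / N)) • p.2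

/-- The mean velocity scheme at grid times `t_j = j T/N`. -/
def mvelStep {d : ℕ} (T : ℝ) (N : ℕ) (V : Measure (Euc d) → Measure (Euc d × Euc d))
    (μ₀ : Measure (Euc d)) : ℕ → Measure (Euc d)
  | 0 => μ₀
  | j + 1 => (mvelStep T N V μ₀ j).map fun x =>
      x + (T / N) • bary (V (mvelStep T N V μ₀ j)) x

/-- Time interpolation of the mean velocity scheme. -/
def mvelT {d : ℕ} (T : ℝ) (N : ℕ) (V : Measure (Euc d) → Measure (Euc d × Euc d))
    (μ₀ : Measure (Euc d)) (t : ℝ) : Measure (Euc d) :=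
  if t ≤ 0 then μ₀
  else
    (mvelStep T N V μ₀ (⌈t / (T / N)⌉.toNat - 1)).map fun x =>
      x + (t - (↑(⌈t / (T / N)⌉.toNat - 1) : ℝ) * (T / N)) •
        bary (V (mvelStep T N V μ₀ (⌈t / (T / N)⌉.toNat - 1))) x

end Schemes

lemma msupp_eq_support {X : Type*} [TopologicalSpace X] [MeasurableSpace X] (μ : Measure X) :
    msupp μ = μ.support := by
  ext x
  rw [Measure.mem_support_iff_forall]
  constructor
  · intro h U hU
    obtain ⟨W, hWU, hW, hx⟩ := mem_nhds_iff.1 hU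
    exact (h W hW hx).trans_le (measure_mono hWU)
  · exact fun h U hU hx => h U (hU.mem_nhds hx)

lemma ae_mem_msupp {X : Type*} [TopologicalSpace X] [HereditarilyLindelofSpace X]
    [MeasurableSpace X] (μ : Measure X) : ∀ᵐ x ∂μ, x ∈ msupp μ := by
  rw [msupp_eq_support]
  exact Measure.support_mem_ae

lemma msupp_subset_of_isClosed {X : Type*} [TopologicalSpace X] [MeasurableSpace X]
    {μ : Measure X} {F : Set X} (hF : IsClosed F) (h : ∀ᵐ x ∂μ, x ∈ F) : msupp μ ⊆ F := by
  rw [msupp_eq_support]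
  exact Measure.support_subset_of_isClosed hF h

/-- A compactly supported probability measure whose support lies in an open ball is carried by
a strictly smaller closed ball. -/
lemma Pc.exists_closedBall {d : ℕ} {μ : Measure (Euc d)} (hμ : Pc μ) {R : ℝ}
    (hR : msupp μ ⊆ ball 0 R) :
    ∃ r, 0 ≤ r ∧ r < R ∧ ∀ᵐ x ∂μ, x ∈ closedBall (0 : Euc d) r := by
  obtain ⟨hprob, K, hK, hμK⟩ := hμ
  have hcpt : IsCompact (msupp μ) := by
    refine hK.of_isClosed_subset ?_ (msupp_subset_of_isClosed hK.isClosed hμK)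
    rw [msupp_eq_support]
    exact Measure.isClosed_support
  obtain ⟨x, hx, hmax⟩ := hcpt.exists_isMaxOn (ae_mem_msupp μ).exists
    continuous_norm.continuousOn
  refine ⟨‖x‖, norm_nonneg x, by simpa using hR hx, ?_⟩
  filter_upwards [ae_mem_msupp μ] with y hy
  simpa using hmax hy

/-- One explicit Euler step of length `s` enlarges a carrying ball of radius `r` to one of radius
at most `exp (C * s) * (r + 1) - 1`. -/
lemma H1cond.ae_map_mem_closedBall {d : ℕ} {C : ℝ}
    {V : Measure (Euc d) → Measure (Euc d × Euc d)} (h1 : H1cond C V) (hC : 0 ≤ C)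
    (hV : IsPVF V) {μ : Measure (Euc d)} [IsProbabilityMeasure μ] {r s : ℝ} (hr : 0 ≤ r)
    (hs : 0 ≤ s) (hμ : ∀ᵐ x ∂μ, x ∈ closedBall (0 : Euc d) r) :
    ∀ᵐ x ∂((V μ).map fun p => p.1 + s • p.2),
      x ∈ closedBall (0 : Euc d) (Real.exp (C * s) * (r + 1) - 1) := by
  have hsup : ⨆ x : msupp μ, ‖(x : Euc d)‖ ≤ r :=
    Real.iSup_le (fun x => by
      simpa using msupp_subset_of_isClosed isClosed_closedBall hμ x.2) hr
  have hfst : ∀ᵐ p ∂V μ, p.1 ∈ closedBall (0 : Euc d) r := by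
    rw [← (hV μ inferInstance).2] at hμ
    exact ae_of_ae_map measurable_fst.aemeasurable hμ
  have hmeas : Measurable fun p : Euc d × Euc d => p.1 + s • p.2 := by fun_prop
  refine (ae_map_iff hmeas.aemeasurable isClosed_closedBall.measurableSet).2 ?_
  filter_upwards [hfst, ae_mem_msupp (V μ)] with p hp hpV
  have hp2 : ‖p.2‖ ≤ C * (1 + r) :=
    (h1 μ ⟨inferInstance, _, isCompact_closedBall 0 r, hμ⟩ p hpV).trans (by gcongr)
  rw [mem_closedBall_zero_iff] at hp
  rw [dist_zero_right]
  calc ‖p.1 + s • p.2‖ ≤ ‖p.1‖ + s * ‖p.2‖ := by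
        simpa [norm_smul, abs_of_nonneg hs] using norm_add_le p.1 (s • p.2)
    _ ≤ r + s * (C * (1 + r)) := by gcongr
    _ = (C * s + 1) * (r + 1) - 1 := by ring
    _ ≤ Real.exp (C * s) * (r + 1) - 1 := by
        gcongr
        exact Real.add_one_le_exp _

lemma IsPVF.isProbabilityMeasure_map {d : ℕ} {V : Measure (Euc d) → Measure (Euc d × Euc d)}
    (hV : IsPVF V) (μ : Measure (Euc d)) [IsProbabilityMeasure μ] (s : ℝ) :
    IsProbabilityMeasure ((V μ).map fun p => p.1 + s • p.2) := by
  have := (hV μ inferInstance).1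
  have hmeas : Measurable fun p : Euc d × Euc d => p.1 + s • p.2 := by fun_prop
  exact Measure.isProbabilityMeasure_map hmeas.aemeasurable

lemma exp_mul_add_one_sub_one_nonneg {a r : ℝ} (ha : 0 ≤ a) (hr : 0 ≤ r) :
    0 ≤ Real.exp a * (r + 1) - 1 := by
  nlinarith [Real.one_le_exp ha]

lemma lagrStep_carried_by_closedBall {d : ℕ} {T C : ℝ} (hT : 0 ≤ T) (N : ℕ)
    {V : Measure (Euc d) → Measure (Euc d × Euc d)} (hV : IsPVF V) (hC : 0 ≤ C)
    (h1 : H1cond C V) {μ₀ : Measure (Euc d)} [IsProbabilityMeasure μ₀] {r : ℝ} (hr : 0 ≤ r)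
    (hμ₀ : ∀ᵐ x ∂μ₀, x ∈ closedBall (0 : Euc d) r) (k : ℕ) :
    IsProbabilityMeasure (lagrStep T N V μ₀ k) ∧
      ∀ᵐ x ∂(lagrStep T N V μ₀ k),
        x ∈ closedBall (0 : Euc d) (Real.exp (C * (k * (T / N))) * (r + 1) - 1) := by
  induction k with
  | zero => exact ⟨‹_›, by simpa [lagrStep] using hμ₀⟩
  | succ k ih =>
    obtain ⟨hprob, hball⟩ := ih
    refine ⟨hV.isProbabilityMeasure_map _ _, ?_⟩
    have h := h1.ae_map_mem_closedBall hC hV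
      (exp_mul_add_one_sub_one_nonneg (by positivity) hr) (by positivity : 0 ≤ T / N) hball
    rw [sub_add_cancel, ← mul_assoc, ← Real.exp_add] at h
    have hexp : C * (T / N) + C * (k * (T / N)) = C * ((k + 1 : ℕ) * (T / N)) := by
      push_cast
      ring
    rwa [hexp] at h

lemma natCast_toNat_ceil_sub_one_mul_le {t δ : ℝ} (ht : 0 ≤ t) (hδ : 0 < δ) :
    ((⌈t / δ⌉.toNat - 1 : ℕ) : ℝ) * δ ≤ t := by
  rw [← le_div_iff₀ hδ, Int.ceil_toNat]
  have hlt := Nat.ceil_lt_add_one (div_nonneg ht hδ.le)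
  rcases Nat.eq_zero_or_pos ⌈t / δ⌉₊ with h | h
  · simpa [h] using div_nonneg ht hδ.le
  · rw [Nat.cast_sub h, Nat.cast_one]
    linarith

/-- uniform support bound, cf. `exp_bound`: under (H1) with constant `C`,
if `supp μ₀ ⊆ B(0,R)`, then `supp μ̄^N_t ⊆ B(0, e^{CT}(R+1))` for all `t ∈ [0,T]` and all `N`. -/
theorem lagrangian_support_bound {d : ℕ} (T : ℝ) (hT : 0 < T)
    (V : Measure (Euc d) → Measure (Euc d × Euc d)) (hV : IsPVF V)
    (C : ℝ) (hC : 0 < C) (h1 : H1cond C V)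
    (μ₀ : Measure (Euc d)) (hμ₀ : Pc μ₀)
    (R : ℝ) (hR : msupp μ₀ ⊆ ball (0 : Euc d) R) :
    ∀ N : ℕ, 0 < N → ∀ t ∈ Icc (0 : ℝ) T,
      msupp (lagrT T N V μ₀ t) ⊆ ball (0 : Euc d) (Real.exp (C * T) * (R + 1)) := by
  intro N hN t ht
  obtain ⟨r, hr, hrR, hball⟩ := hμ₀.exists_closedBall hR
  have := hμ₀.1
  have hradius : Real.exp (C * t) * (r + 1) - 1 < Real.exp (C * T) * (R + 1) := by
    have h : Real.exp (C * t) * (r + 1) ≤ Real.exp (C * T) * (R + 1) := by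
      gcongr
      exact ht.2
    linarith
  refine Subset.trans (msupp_subset_of_isClosed isClosed_closedBall ?_)
    (closedBall_subset_ball hradius)
  unfold lagrT
  split_ifs with h
  · obtain rfl : t = 0 := le_antisymm h ht.1
    simpa using hball
  · have hδ : 0 < T / N := by positivity
    obtain ⟨hprob, hk⟩ := lagrStep_carried_by_closedBall hT.le N hV hC.le h1 hr hball
      (⌈t / (T / N)⌉.toNat - 1)
    have hstep := h1.ae_map_mem_closedBall hC.le hV
      (exp_mul_add_one_sub_one_nonneg (by positivity) hr)
      (sub_nonneg.2 (natCast_toNat_ceil_sub_one_mul_le ht.1 hδ)) hk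
    rw [sub_add_cancel, ← mul_assoc, ← Real.exp_add] at hstep
    rwa [← mul_add, sub_add_cancel] at hstep

end
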